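/- Let G be a strongly connected, weight-balanced digraph and each f^i : ℝ^d → ℝ convex and differentiable with globally Lipschitz gradient with constant K. Then there exists β* > 0 (a root of the function h of the paper) such that for all 0 < β < β* and α = (β² + 2)/β, the projection onto the first component of any trajectory of ẋ = −α𝐋x − 𝐋z − ∇f̃(x), ż = 𝐋x asymptotically converges to the set {1_n ⊗ x : x minimizes Σ_i f^i}. -/

import Mathlib

open Matrix BigOperators Filter

lemma dotProduct_self_nonneg_real {κ : Type*} [Fintype κ] (v : κ → ℝ) : 0 ≤ v ⬝ᵥ v :=
  Finset.sum_nonneg fun _ _ => mul_self_nonneg _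

/-- First-order characterization of convexity in terms of directional derivatives. -/
lemma ConvexOn.add_dotProduct_le {κ : Type*} [Fintype κ] {f : (κ → ℝ) → ℝ}
    (hf : ConvexOn ℝ Set.univ f) {x g : κ → ℝ}
    (hg : ∀ w, HasDerivAt (fun s : ℝ => f (x + s • w)) (g ⬝ᵥ w) 0) (y : κ → ℝ) :
    f x + g ⬝ᵥ (y - x) ≤ f y := by
  have hline : ConvexOn ℝ Set.univ (fun s : ℝ => f (x + s • (y - x))) := by
    have := hf.comp_affineMap (AffineMap.lineMap x y : ℝ →ᵃ[ℝ] (κ → ℝ))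
    simpa [Function.comp_def, AffineMap.lineMap_apply, add_comm] using this
  have := hline.le_slope_of_hasDerivAt (Set.mem_univ 0) (Set.mem_univ 1) one_pos (hg (y - x))
  rw [slope_def_field] at this
  simp only [zero_smul, add_zero, one_smul, sub_zero, div_one, add_sub_cancel] at this
  linarith

/-- Cocoercivity, with constant `1 / (2 * K)`, of the `K`-Lipschitz gradient of a convex function. -/
lemma ConvexOn.gradient_cocoercive {κ : Type*} [Fintype κ] {f : (κ → ℝ) → ℝ}
    (hf : ConvexOn ℝ Set.univ f) {g : (κ → ℝ) → (κ → ℝ)}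
    (hg : ∀ v w, HasDerivAt (fun s : ℝ => f (v + s • w)) (g v ⬝ᵥ w) 0) {K : ℝ} (hK : 0 < K)
    (hlip : ∀ v w, (g v - g w) ⬝ᵥ (g v - g w) ≤ K ^ 2 * ((v - w) ⬝ᵥ (v - w)))
    (a b : κ → ℝ) :
    (g b - g a) ⬝ᵥ (g b - g a) ≤ 2 * K * ((b - a) ⬝ᵥ (g b - g a)) := by
  have key : ∀ a b : κ → ℝ,
      f a + g a ⬝ᵥ (b - a) + (g b - g a) ⬝ᵥ (g b - g a) / (4 * K) ≤ f b := by
    intro a b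
    set G := g b - g a with hG
    set t : ℝ := 1 / (2 * K) with ht
    set y := b - t • G with hy
    have h1 := hf.add_dotProduct_le (hg a) y
    have h2 := hf.add_dotProduct_le (hg y) b
    have hl := hlip y b
    have hyb : y - b = -(t • G) := by simp [hy]
    have hby : b - y = t • G := by simp [hy]
    have hya : y - a = (b - a) - t • G := by rw [hy]; abel
    have hyoung : 0 ≤ ((g y - g b) + (K * t) • G) ⬝ᵥ ((g y - g b) + (K * t) • G) :=
      dotProduct_self_nonneg_real _
    rw [hyb] at hl
    rw [hby] at h2
    rw [hya] at h1
    set D := g y - g b with hD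
    have hgy : g y = D + G + g a := by rw [hD, hG]; abel
    rw [hgy] at h2
    simp only [dotProduct_add, add_dotProduct, dotProduct_sub, dotProduct_neg, neg_dotProduct,
      dotProduct_smul, smul_dotProduct, smul_eq_mul, dotProduct_comm G D] at *
    have hKt : K * t = 1 / 2 := by rw [ht]; field_simp
    have ht0 : 0 < t := by positivity
    have hl' : D ⬝ᵥ D ≤ G ⬝ᵥ G / 4 := by
      have : K ^ 2 * -(t * -(t * G ⬝ᵥ G)) = (K * t) ^ 2 * G ⬝ᵥ G := by ring
      rw [this, hKt] at hl
      linarith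
    rw [hKt] at hyoung
    have hDG : -(G ⬝ᵥ G) / 2 ≤ D ⬝ᵥ G := by linarith
    have h4 : G ⬝ᵥ G / (4 * K) = t * (G ⬝ᵥ G / 2) := by rw [ht]; field_simp; norm_num
    rw [h4]
    nlinarith
  have h1 := key a b
  have h2 := key b a
  have e1 : (g a - g b) ⬝ᵥ (g a - g b) = (g b - g a) ⬝ᵥ (g b - g a) := by
    rw [← neg_sub, neg_dotProduct_neg]
  have e2 : (b - a) ⬝ᵥ (g b - g a) = -(g a ⬝ᵥ (b - a)) - g b ⬝ᵥ (a - b) := by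
    rw [dotProduct_comm, sub_dotProduct, ← neg_sub b a, dotProduct_neg]; ring
  rw [e1] at h2
  have h3 : (g b - g a) ⬝ᵥ (g b - g a) / (4 * K) * 2 ≤ (b - a) ⬝ᵥ (g b - g a) := by
    linarith
  calc _ = 2 * K * ((g b - g a) ⬝ᵥ (g b - g a) / (4 * K) * 2) := by field_simp; norm_num
    _ ≤ _ := by gcongr

/-- Along a bounded trajectory of a continuous vector field, the dissipation rate of a Lyapunov
function tends to zero. -/
lemma tendsto_dissipation_zero {E : Type*} [NormedAddCommGroup E] [NormedSpace ℝ E]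
    {k : Set E} (hk : IsCompact k) {F : E → E} (hF : ContinuousOn F k)
    {γ : ℝ → E} (hγ : ∀ t, HasDerivAt γ (F (γ t)) t) (hγk : ∀ t, 0 ≤ t → γ t ∈ k)
    {R : E → ℝ} (hR : ContinuousOn R k) (hR0 : ∀ x, 0 ≤ R x)
    {V V' : ℝ → ℝ} (hV : ∀ t, HasDerivAt V (V' t) t) (hV' : ∀ t, V' t ≤ -R (γ t))
    (hV0 : ∀ t, 0 ≤ V t) :
    Tendsto (fun t => R (γ t)) atTop (nhds 0) := by
  have hVanti : Antitone V := by
    refine antitone_of_deriv_nonpos (fun t => (hV t).differentiableAt) fun t => ?_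
    rw [(hV t).deriv]
    linarith [hV' t, hR0 (γ t)]
  obtain ⟨l, hl⟩ : ∃ l, Tendsto V atTop (nhds l) :=
    ⟨_, tendsto_atTop_ciInf hVanti ⟨0, by rintro _ ⟨t, rfl⟩; exact hV0 t⟩⟩
  obtain ⟨C, hC⟩ := hk.exists_bound_of_continuousOn hF
  have hlip : ∀ s t, 0 ≤ s → s ≤ t → ‖γ t - γ s‖ ≤ (|C| + 1) * (t - s) := by
    intro s t hs hst
    have := (convex_Ici (0 : ℝ)).norm_image_sub_le_of_norm_hasDerivWithin_le
      (f := γ) (f' := fun t => F (γ t)) (C := |C| + 1) (x := s) (y := t)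
      (fun r _ => (hγ r).hasDerivWithinAt)
      (fun r hr => ((hC _ (hγk r hr)).trans (le_abs_self C)).trans (by linarith))
      hs (hs.trans hst)
    rwa [Real.norm_of_nonneg (sub_nonneg.2 hst)] at this
  have hRu := hk.uniformContinuousOn_of_continuous hR
  rw [Metric.tendsto_atTop]
  intro ε hε
  obtain ⟨δ, hδ, hRδ⟩ := Metric.uniformContinuousOn_iff.1 hRu (ε / 2) (half_pos hε)
  have hM : 0 < |C| + 1 := by positivity
  set τ : ℝ := δ / (2 * (|C| + 1)) with hτ
  have hτ0 : 0 < τ := by positivity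
  have hdrop : Tendsto (fun t => V t - V (t + τ)) atTop (nhds 0) := by
    simpa using hl.sub (hl.comp (tendsto_atTop_add_const_right _ τ tendsto_id))
  obtain ⟨N, hN⟩ := eventually_atTop.1 (hdrop.eventually_lt_const (show 0 < ε / 2 * τ by positivity))
  refine ⟨max N 0, fun t ht => ?_⟩
  have ht0 : 0 ≤ t := (le_max_right _ _).trans ht
  rw [Real.dist_0_eq_abs, abs_of_nonneg (hR0 _)]
  by_contra! hcon
  have hlow : ∀ s ∈ Set.Icc t (t + τ), V' s ≤ -(ε / 2) := by
    intro s hs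
    have hd : dist (γ t) (γ s) < δ := by
      rw [dist_comm, dist_eq_norm]
      calc _ ≤ (|C| + 1) * (s - t) := hlip t s ht0 hs.1
        _ ≤ (|C| + 1) * τ := by gcongr; linarith [hs.2]
        _ = δ / 2 := by rw [hτ]; field_simp
        _ < δ := half_lt_self hδ
    have := hRδ _ (hγk t ht0) _ (hγk s (ht0.trans hs.1)) hd
    rw [Real.dist_eq] at this
    linarith [le_abs_self (R (γ t) - R (γ s)), hV' s]
  obtain ⟨c, hc, hceq⟩ := exists_hasDerivAt_eq_slope V V' (show t < t + τ by linarith)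
    (fun s _ => (hV s).continuousAt.continuousWithinAt) (fun s _ => hV s)
  have h1 := hlow c ⟨hc.1.le, hc.2.le⟩
  rw [hceq, add_sub_cancel_left, div_le_iff₀ hτ0] at h1
  linarith [hN t ((le_max_left _ _).trans ht)]

/-- On a compact set, `D` tends to zero whenever a nonnegative `R` whose zeros are zeros of `D`
tends to zero. -/
lemma tendsto_zero_of_compact_of_zeros_subset {E : Type*} [TopologicalSpace E]
    {k : Set E} (hk : IsCompact k) {R D : E → ℝ} (hR : ContinuousOn R k) (hD : Continuous D)
    (hR0 : ∀ x, 0 ≤ R x) (hD0 : ∀ x, 0 ≤ D x) (hRD : ∀ x ∈ k, R x = 0 → D x = 0)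
    {γ : ℝ → E} (hγk : ∀ t, 0 ≤ t → γ t ∈ k)
    (h : Tendsto (fun t => R (γ t)) atTop (nhds 0)) :
    Tendsto (fun t => D (γ t)) atTop (nhds 0) := by
  refine tendsto_order.2 ⟨fun a ha => .of_forall fun t => ha.trans_le (hD0 _), fun ε hε => ?_⟩
  have hk' : IsCompact (k ∩ {x | ε ≤ D x}) := hk.inter_right (isClosed_le continuous_const hD)
  rcases (k ∩ {x | ε ≤ D x}).eq_empty_or_nonempty with he | hne
  · filter_upwards [eventually_ge_atTop 0] with t ht
    by_contra! hcon
    exact Set.eq_empty_iff_forall_notMem.1 he (γ t) ⟨hγk t ht, hcon⟩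
  · obtain ⟨y, hy, hmin⟩ := hk'.exists_isMinOn hne (hR.mono Set.inter_subset_left)
    have hRy : 0 < R y := (hR0 y).lt_of_ne' fun h0 => by
      have h1 : ε ≤ D y := hy.2
      have := hRD y hy.1 h0
      linarith
    filter_upwards [eventually_ge_atTop 0, h.eventually_lt_const hRy] with t ht hlt
    by_contra! hcon
    exact (isMinOn_iff.1 hmin _ ⟨hγk t ht, hcon⟩).not_gt hlt

/-- A continuous function on `(0, ∞)`, negative near `0` and somewhere nonnegative, has a first
positive zero. -/
lemma exists_first_pos_zero {h : ℝ → ℝ} (hc : ContinuousOn h (Set.Ioi 0)) {a b : ℝ} (ha : 0 < a)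
    (hneg : ∀ r, 0 < r → r ≤ a → h r < 0) (hb : 0 < b) (hpos : 0 ≤ h b) :
    ∃ r, 0 < r ∧ h r = 0 ∧ ∀ s, 0 < s → s < r → h s < 0 := by
  have hab : a < b := by
    by_contra! hcon
    exact (hneg b hb hcon).not_ge hpos
  have hc' : ContinuousOn h (Set.Icc a b) := hc.mono fun x hx => ha.trans_le hx.1
  have hK : IsCompact (Set.Icc a b ∩ h ⁻¹' Set.Ici 0) :=
    isCompact_Icc.of_isClosed_subset (hc'.preimage_isClosed_of_isClosed isClosed_Icc isClosed_Ici)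
      Set.inter_subset_left
  obtain ⟨r, hr, hmin⟩ := hK.exists_isLeast ⟨b, ⟨hab.le, le_rfl⟩, hpos⟩
  have hlt : ∀ s, 0 < s → s < r → h s < 0 := by
    intro s hs hsr
    by_contra! hcon
    rcases le_or_gt s a with hsa | hsa
    · exact (hneg s hs hsa).not_ge hcon
    · exact (hmin ⟨⟨hsa.le, hsr.le.trans hr.1.2⟩, hcon⟩).not_gt hsr
  have har : a ≤ r := hr.1.1
  refine ⟨r, ha.trans_le har, le_antisymm ?_ hr.2, hlt⟩
  obtain ⟨s, hs, hs0⟩ := intermediate_value_Icc har (hc'.mono (Set.Icc_subset_Icc_right hr.1.2))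
    ⟨(hneg a ha le_rfl).le, hr.2⟩
  have := hmin ⟨⟨hs.1, hs.2.trans hr.1.2⟩, hs0.ge⟩
  rw [le_antisymm this hs.2, hs0]

section Laplacian

variable {ι : Type*} [Fintype ι] [DecidableEq ι] {A L : Matrix ι ι ℝ}

/-- The quadratic form of the Laplacian of a weight-balanced digraph. -/
lemma dotProduct_laplacian_mulVec (hbal : ∀ i, ∑ j, A i j = ∑ j, A j i)
    (hL : L = Matrix.diagonal (fun i => ∑ j, A i j) - A) (v : ι → ℝ) :
    v ⬝ᵥ (L *ᵥ v) = 1 / 2 * ∑ i, ∑ j, A i j * (v i - v j) ^ 2 := by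
  have h1 : v ⬝ᵥ (L *ᵥ v) = ∑ i, ∑ j, A i j * v i ^ 2 - ∑ i, ∑ j, A i j * (v i * v j) := by
    rw [hL, sub_mulVec, dotProduct_sub]
    simp only [dotProduct, mulVec_diagonal]
    simp only [mulVec, dotProduct, Finset.mul_sum, Finset.sum_mul]
    congr 1 <;> exact Finset.sum_congr rfl fun i _ => Finset.sum_congr rfl fun j _ => by ring
  have h2 : ∑ i, ∑ j, A i j * v j ^ 2 = ∑ i, ∑ j, A i j * v i ^ 2 := by
    rw [Finset.sum_comm]
    simp only [← Finset.sum_mul, hbal]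
  have h3 : ∑ i, ∑ j, A i j * (v i - v j) ^ 2 = ∑ i, ∑ j, A i j * v i ^ 2
      + ∑ i, ∑ j, A i j * v j ^ 2 - 2 * ∑ i, ∑ j, A i j * (v i * v j) := by
    simp only [Finset.mul_sum, ← Finset.sum_add_distrib, ← Finset.sum_sub_distrib]
    exact Finset.sum_congr rfl fun i _ => Finset.sum_congr rfl fun j _ => by ring
  rw [h1, h3, h2]
  ring

lemma dotProduct_laplacian_mulVec_nonneg (hA : ∀ i j, 0 ≤ A i j)
    (hbal : ∀ i, ∑ j, A i j = ∑ j, A j i)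
    (hL : L = Matrix.diagonal (fun i => ∑ j, A i j) - A) (v : ι → ℝ) :
    0 ≤ v ⬝ᵥ (L *ᵥ v) := by
  rw [dotProduct_laplacian_mulVec hbal hL]
  have := Finset.sum_nonneg fun i (_ : i ∈ Finset.univ) =>
    Finset.sum_nonneg fun j (_ : j ∈ Finset.univ) => mul_nonneg (hA i j) (sq_nonneg (v i - v j))
  positivity

/-- On a strongly connected digraph, the Laplacian form vanishes only on consensus vectors. -/
lemma eq_of_dotProduct_laplacian_mulVec_eq_zero (hA : ∀ i j, 0 ≤ A i j)
    (hconn : ∀ i j : ι, i ≠ j → Relation.TransGen (fun a b => 0 < A a b) i j)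
    (hbal : ∀ i, ∑ j, A i j = ∑ j, A j i)
    (hL : L = Matrix.diagonal (fun i => ∑ j, A i j) - A) {v : ι → ℝ}
    (hv : v ⬝ᵥ (L *ᵥ v) = 0) (i j : ι) : v i = v j := by
  rw [dotProduct_laplacian_mulVec hbal hL] at hv
  have hedge : ∀ a b, 0 < A a b → v a = v b := by
    intro a b hab
    have hterm : ∀ i j, 0 ≤ A i j * (v i - v j) ^ 2 := fun i j =>
      mul_nonneg (hA i j) (sq_nonneg _)
    have h1 := (Finset.sum_eq_zero_iff_of_nonneg fun i _ =>
      Finset.sum_nonneg fun j _ => hterm i j).1 (by linarith) a (Finset.mem_univ a)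
    have h2 := (Finset.sum_eq_zero_iff_of_nonneg fun j _ => hterm a j).1 h1 b (Finset.mem_univ b)
    exact sub_eq_zero.1 (by simpa [hab.ne'] using h2)
  by_cases hij : i = j
  · rw [hij]
  · induction hconn i j hij with
    | single hab => exact hedge _ _ hab
    | tail _ hbc ih =>
      rename_i b c _
      exact (by
        by_cases hib : i = b
        · rw [hib]
        · exact ih hib : v i = v b).trans (hedge _ _ hbc)

lemma sum_laplacian_mulVec (hbal : ∀ i, ∑ j, A i j = ∑ j, A j i)
    (hL : L = Matrix.diagonal (fun i => ∑ j, A i j) - A) (v : ι → ℝ) :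
    ∑ i, (L *ᵥ v) i = 0 := by
  simp only [hL, sub_mulVec, Pi.sub_apply, mulVec_diagonal, Finset.sum_sub_distrib]
  simp only [mulVec, dotProduct]
  rw [Finset.sum_comm, sub_eq_zero]
  simp only [← Finset.sum_mul, hbal]

lemma laplacian_mulVec_const (hL : L = Matrix.diagonal (fun i => ∑ j, A i j) - A) (c : ℝ) :
    L *ᵥ (fun _ => c) = 0 := by
  ext i
  rw [hL, sub_mulVec, Pi.sub_apply, mulVec_diagonal, mulVec, dotProduct, Finset.sum_mul, sub_self,
    Pi.zero_apply]

/-- The Laplacian of a strongly connected weight-balanced digraph maps onto the zero-sum vectors,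
with a preimage of any prescribed sum. -/
lemma exists_laplacian_mulVec_eq (hA : ∀ i j, 0 ≤ A i j)
    (hconn : ∀ i j : ι, i ≠ j → Relation.TransGen (fun a b => 0 < A a b) i j)
    (hbal : ∀ i, ∑ j, A i j = ∑ j, A j i)
    (hL : L = Matrix.diagonal (fun i => ∑ j, A i j) - A) [Nonempty ι]
    {c : ι → ℝ} (hc : ∑ i, c i = 0) (s : ℝ) :
    ∃ v : ι → ℝ, L *ᵥ v = c ∧ ∑ i, v i = s := by
  have hcard : (Fintype.card ι : ℝ) ≠ 0 := by simp
  let T : (ι → ℝ) →ₗ[ℝ] (ι → ℝ) := (L + Matrix.of fun _ _ => (1 : ℝ)).mulVecLin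
  have hT : ∀ v, T v = L *ᵥ v + fun _ => ∑ i, v i := fun v => by
    ext i
    simp only [T, mulVecLin_apply, add_mulVec, Pi.add_apply]
    simp [mulVec, dotProduct]
  have hsum : ∀ v, ∑ i, T v i = Fintype.card ι * ∑ i, v i := fun v => by
    rw [hT]
    simp [Finset.sum_add_distrib, sum_laplacian_mulVec hbal hL]
  have hinj : Function.Injective T := by
    refine (injective_iff_map_eq_zero T).2 fun v hv => ?_
    have h0 : ∑ i, v i = 0 := by
      have := hsum v
      rw [hv] at this
      simpa [hcard] using this
    have hLv : L *ᵥ v = 0 := by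
      rw [hT, h0] at hv
      ext i
      simpa using congrFun hv i
    have hconst := eq_of_dotProduct_laplacian_mulVec_eq_zero hA hconn hbal hL
      (v := v) (by rw [hLv, dotProduct_zero])
    ext i
    rw [Finset.sum_congr rfl fun j _ => hconst j i] at h0
    simpa [hcard] using h0
  obtain ⟨v, hv⟩ := LinearMap.surjective_of_injective hinj (c + fun _ => s)
  have hvs : ∑ i, v i = s := by
    have := hsum v
    rw [hv] at this
    simp only [Pi.add_apply, Finset.sum_add_distrib, hc, Finset.sum_const, Finset.card_univ,
      nsmul_eq_mul, zero_add] at this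
    exact (mul_left_cancel₀ hcard this).symm
  refine ⟨v, ?_, hvs⟩
  rw [hT, hvs] at hv
  exact add_right_cancel hv

/-- Spectral gap of the symmetrized Laplacian on zero-sum vectors. -/
lemma spectral_gap_laplacian (hA : ∀ i j, 0 ≤ A i j)
    (hconn : ∀ i j : ι, i ≠ j → Relation.TransGen (fun a b => 0 < A a b) i j)
    (hbal : ∀ i, ∑ j, A i j = ∑ j, A j i)
    (hL : L = Matrix.diagonal (fun i => ∑ j, A i j) - A) {Λ : ℝ}
    (hΛmin : ∀ (μ : ℝ) (v : ι → ℝ), v ≠ 0 → (L + Lᵀ) *ᵥ v = μ • v → μ ≠ 0 → Λ ≤ |μ|)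
    {v : ι → ℝ} (hv : ∑ i, v i = 0) :
    Λ / 2 * (v ⬝ᵥ v) ≤ v ⬝ᵥ (L *ᵥ v) := by
  have hH : (L + Lᵀ).IsHermitian := by
    rw [Matrix.IsHermitian, conjTranspose_eq_transpose_of_trivial, transpose_add,
      transpose_transpose, add_comm]
  have hquad : ∀ w : ι → ℝ, w ⬝ᵥ ((L + Lᵀ) *ᵥ w) = 2 * (w ⬝ᵥ (L *ᵥ w)) := fun w => by
    rw [add_mulVec, dotProduct_add, mulVec_transpose, dotProduct_comm w (w ᵥ* L),
      ← dotProduct_mulVec]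
    ring
  set e : ι → ι → ℝ := fun k => ⇑(hH.eigenvectorBasis k) with he
  have hMe : ∀ k, (L + Lᵀ) *ᵥ e k = hH.eigenvalues k • e k := hH.mulVec_eigenvectorBasis
  have hexp : ∀ x y : ι → ℝ, ∑ k, (x ⬝ᵥ e k) * (e k ⬝ᵥ y) = x ⬝ᵥ y := fun x y => by
    have := hH.eigenvectorBasis.sum_inner_mul_inner (WithLp.toLp 2 x) (WithLp.toLp 2 y)
    simpa [EuclideanSpace.inner_eq_star_dotProduct, dotProduct_comm, he] using this
  have hee : ∀ k, e k ⬝ᵥ e k = 1 := fun k => by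
    have := hH.eigenvectorBasis.orthonormal.1 k
    rw [← sq_eq_sq₀ (norm_nonneg _) zero_le_one, ← real_inner_self_eq_norm_sq,
      EuclideanSpace.inner_eq_star_dotProduct] at this
    simpa [he] using this
  have heM : ∀ k, e k ⬝ᵥ ((L + Lᵀ) *ᵥ v) = hH.eigenvalues k * (e k ⬝ᵥ v) := fun k => by
    have hT : (L + Lᵀ)ᵀ = L + Lᵀ := by rw [transpose_add, transpose_transpose, add_comm]
    rw [dotProduct_mulVec, ← mulVec_transpose, hT, hMe, smul_dotProduct, smul_eq_mul]
  have hterm : ∀ k, Λ * ((v ⬝ᵥ e k) * (e k ⬝ᵥ v))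
      ≤ (v ⬝ᵥ e k) * (e k ⬝ᵥ ((L + Lᵀ) *ᵥ v)) := by
    intro k
    rw [heM, dotProduct_comm v]
    have hform := hquad (e k)
    rw [hMe, dotProduct_smul, hee, smul_eq_mul, mul_one] at hform
    have hnonneg : 0 ≤ hH.eigenvalues k := by
      rw [hform]
      exact mul_nonneg two_pos.le (dotProduct_laplacian_mulVec_nonneg hA hbal hL _)
    by_cases h0 : hH.eigenvalues k = 0
    · have hconst := eq_of_dotProduct_laplacian_mulVec_eq_zero hA hconn hbal hL
        (v := e k) (by linarith)
      have hev : e k ⬝ᵥ v = 0 := by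
        rw [dotProduct, Finset.sum_congr rfl fun j _ => by rw [hconst j k], ← Finset.mul_sum, hv,
          mul_zero]
      simp [hev]
    · have hne : e k ≠ 0 := fun h => by simpa [h] using hee k
      have := hΛmin _ _ hne (hMe k) h0
      rw [abs_of_nonneg hnonneg] at this
      nlinarith [mul_self_nonneg (e k ⬝ᵥ v)]
  have := Finset.sum_le_sum fun k (_ : k ∈ Finset.univ) => hterm k
  rw [← Finset.mul_sum, hexp, hexp, hquad] at this
  linarith

end Laplacian

section Kronecker

variable {ι κ : Type*} [Fintype ι] [Fintype κ] [DecidableEq κ]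

lemma kronecker_one_mulVec (L : Matrix ι ι ℝ) (v : ι × κ → ℝ) (p : ι × κ) :
    (Matrix.kroneckerMap (· * ·) L (1 : Matrix κ κ ℝ) *ᵥ v) p =
      (L *ᵥ fun i => v (i, p.2)) p.1 := by
  simp [mulVec, dotProduct, Fintype.sum_prod_type, Matrix.one_apply]

lemma dotProduct_kronecker_one_mulVec (L : Matrix ι ι ℝ) (v w : ι × κ → ℝ) :
    v ⬝ᵥ (Matrix.kroneckerMap (· * ·) L (1 : Matrix κ κ ℝ) *ᵥ w) =
      ∑ j, (fun i => v (i, j)) ⬝ᵥ (L *ᵥ fun i => w (i, j)) := by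
  simp only [dotProduct, kronecker_one_mulVec]
  rw [Fintype.sum_prod_type, Finset.sum_comm]

end Kronecker

lemma HasDerivAt.dotProduct {κ : Type*} [Fintype κ] {u v : ℝ → κ → ℝ} {u' v' : κ → ℝ} {t : ℝ}
    (hu : HasDerivAt u u' t) (hv : HasDerivAt v v' t) :
    HasDerivAt (fun s => u s ⬝ᵥ v s) (u' ⬝ᵥ v t + u t ⬝ᵥ v') t := by
  simp only [_root_.dotProduct, ← Finset.sum_add_distrib]
  exact HasDerivAt.fun_sum fun i _ => (hasDerivAt_pi.1 hu i).mul (hasDerivAt_pi.1 hv i)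

lemma norm_le_sqrt_dotProduct_self {κ : Type*} [Fintype κ] (v : κ → ℝ) :
    ‖v‖ ≤ √(v ⬝ᵥ v) := by
  refine (pi_norm_le_iff_of_nonneg (Real.sqrt_nonneg _)).2 fun i => Real.abs_le_sqrt ?_
  rw [sq]
  exact Finset.single_le_sum (f := fun i => v i * v i) (fun _ _ => mul_self_nonneg _)
    (Finset.mem_univ i)

lemma continuous_of_dotProduct_lipschitz {κ : Type*} [Fintype κ] {g : (κ → ℝ) → (κ → ℝ)} {K : ℝ}
    (hlip : ∀ v w, (g v - g w) ⬝ᵥ (g v - g w) ≤ K ^ 2 * ((v - w) ⬝ᵥ (v - w))) :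
    Continuous g := by
  refine continuous_iff_continuousAt.2 fun w => tendsto_iff_norm_sub_tendsto_zero.2 ?_
  refine squeeze_zero (g := fun v => √(K ^ 2 * ((v - w) ⬝ᵥ (v - w)))) (fun _ => norm_nonneg _)
    (fun v => (norm_le_sqrt_dotProduct_self _).trans (Real.sqrt_le_sqrt (hlip v w))) ?_
  have hc : Continuous fun v => √(K ^ 2 * ((v - w) ⬝ᵥ (v - w))) := by fun_prop
  simpa using hc.tendsto w

lemma sum_gradient_eq_zero_of_minimizer {ι κ : Type*} [Fintype ι] [Fintype κ] [DecidableEq κ]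
    {f : ι → (κ → ℝ) → ℝ} {gf : ι → (κ → ℝ) → (κ → ℝ)}
    (hgrad : ∀ (i : ι) (v w : κ → ℝ), HasDerivAt (fun s : ℝ => f i (v + s • w)) (gf i v ⬝ᵥ w) 0)
    {x : κ → ℝ} (hx : ∀ y, ∑ i, f i x ≤ ∑ i, f i y) (j : κ) : ∑ i, gf i x j = 0 := by
  have hd : HasDerivAt (fun s : ℝ => ∑ i, f i (x + s • Pi.single j 1))
      (∑ i, gf i x ⬝ᵥ Pi.single j 1) 0 := HasDerivAt.fun_sum fun i _ => hgrad i x _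
  have hmin : IsLocalMin (fun s : ℝ => ∑ i, f i (x + s • Pi.single j 1)) 0 :=
    .of_forall fun s => by simpa using hx _
  simpa using hmin.hasDerivAt_eq_zero hd

section StepFunction

/-- The bounds on the smaller root `(s - √(s² - 4)) / 2` of `X² - s X + 1` used to locate the zero
of the step-size function. -/
lemma sqrt_sq_sub_four_bounds {s : ℝ} (hs : 2 ≤ s) :
    s - 4 / s ≤ √(s ^ 2 - 4) ∧ √(s ^ 2 - 4) ≤ s - 2 / s := by
  have hs0 : 0 < s := by linarith
  have h1 : (4 / s) ^ 2 ≤ 4 := by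
    have : 4 / s ≤ 2 := by rw [div_le_iff₀ hs0]; linarith
    have : 0 ≤ 4 / s := by positivity
    nlinarith
  constructor
  · apply Real.le_sqrt_of_sq_le
    have : (s - 4 / s) ^ 2 = s ^ 2 - 8 + (4 / s) ^ 2 := by field_simp; ring
    linarith
  · have h2 : 2 / s ≤ s := by rw [div_le_iff₀ hs0]; nlinarith
    refine Real.sqrt_le_iff.2 ⟨by linarith, ?_⟩
    have : (s - 2 / s) ^ 2 = s ^ 2 - 4 + (2 / s) ^ 2 := by field_simp; ring
    nlinarith [sq_nonneg (2 / s)]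

lemma two_lt_step_trace {r : ℝ} (hr : 0 < r) : 2 < (r ^ 4 + 3 * r ^ 2 + 2) / r := by
  rw [lt_div_iff₀ hr]
  nlinarith [sq_nonneg (r - 1), sq_nonneg (r ^ 2)]

lemma exists_first_zero_step_function {Λ K : ℝ} (hΛ : 0 < Λ) (hK : 0 < K) {h : ℝ → ℝ}
    (hh : h = fun r => (1 / 2) * Λ *
        (-((r ^ 4 + 3 * r ^ 2 + 2) / r) +
          Real.sqrt (((r ^ 4 + 3 * r ^ 2 + 2) / r) ^ 2 - 4)) +
        K * r ^ 2 / (1 + r ^ 2)) :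
    ∃ r, 0 < r ∧ h r = 0 ∧ ∀ s, 0 < s → s < r → h s < 0 := by
  have hinv : ∀ r : ℝ, 0 < r → ∀ c : ℝ,
      (1 / 2) * Λ * (-(c / ((r ^ 4 + 3 * r ^ 2 + 2) / r))) + K * r ^ 2 / (1 + r ^ 2)
        = r / ((1 + r ^ 2) * (r ^ 2 + 2)) * (K * r * (r ^ 2 + 2) - c / 2 * Λ) := by
    intro r hr c
    have : r ^ 4 + 3 * r ^ 2 + 2 = (1 + r ^ 2) * (r ^ 2 + 2) := by ring
    rw [this]
    field_simp
    ring
  have ha : 0 < min 1 (Λ / (4 * K)) := by positivity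
  have hb : 0 < Λ / K := by positivity
  refine exists_first_pos_zero ?_ ha ?_ hb ?_
  · rw [hh]
    have h0 : ∀ r ∈ Set.Ioi (0 : ℝ), r ≠ 0 := fun r hr => (Set.mem_Ioi.1 hr).ne'
    have h1 : ∀ r ∈ Set.Ioi (0 : ℝ), 1 + r ^ 2 ≠ 0 := fun r _ => by positivity
    fun_prop (disch := assumption)
  · intro r hr hra
    have hr1 : r ≤ 1 := hra.trans (min_le_left _ _)
    have hrK : r * (4 * K) ≤ Λ := by
      rw [← le_div_iff₀ (by positivity)]
      exact hra.trans (min_le_right _ _)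
    have hneg : r / ((1 + r ^ 2) * (r ^ 2 + 2)) * (K * r * (r ^ 2 + 2) - 2 / 2 * Λ) < 0 := by
      refine mul_neg_of_pos_of_neg (by positivity) ?_
      have : K * r * (r ^ 2 + 2) ≤ K * r * 3 := by gcongr; nlinarith
      linarith
    rw [← hinv r hr] at hneg
    rw [hh]
    have := (sqrt_sq_sub_four_bounds (two_lt_step_trace hr).le).2
    dsimp only
    refine lt_of_le_of_lt ?_ hneg
    gcongr
    linarith
  · set r := Λ / K with hr
    have hpos : 0 ≤ r / ((1 + r ^ 2) * (r ^ 2 + 2)) * (K * r * (r ^ 2 + 2) - 4 / 2 * Λ) := by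
      refine mul_nonneg (by positivity) ?_
      have : K * r = Λ := by rw [hr]; field_simp
      rw [this]
      nlinarith [sq_nonneg r]
    rw [← hinv r hb] at hpos
    rw [hh]
    have := (sqrt_sq_sub_four_bounds (two_lt_step_trace hb).le).1
    dsimp only
    refine hpos.trans ?_
    gcongr
    linarith

/-- The smaller eigenvalue of the matrix `!![(β⁴ + 2β² + 2)/β, 1 + β²; 1 + β², β]`, which has
determinant one. -/
lemma step_eigenvalue {β lam : ℝ} (hβ : 0 < β)
    (hlam : lam = ((β ^ 4 + 3 * β ^ 2 + 2) / β - √(((β ^ 4 + 3 * β ^ 2 + 2) / β) ^ 2 - 4)) / 2) :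
    0 < lam ∧ lam < β ∧
      ((β ^ 4 + 2 * β ^ 2 + 2) / β - lam) * (β - lam) = (1 + β ^ 2) ^ 2 := by
  set s := (β ^ 4 + 3 * β ^ 2 + 2) / β with hs
  have hs2 : 2 < s := two_lt_step_trace hβ
  have hsa : (β ^ 4 + 2 * β ^ 2 + 2) / β = s - β := by rw [hs]; field_simp; ring
  have hsβ : s * β = β ^ 4 + 3 * β ^ 2 + 2 := by rw [hs]; field_simp
  have hnn : 0 ≤ s ^ 2 - 4 := by nlinarith
  have hsq : √(s ^ 2 - 4) ^ 2 = s ^ 2 - 4 := Real.sq_sqrt hnn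
  have hroot : lam ^ 2 - s * lam + 1 = 0 := by rw [hlam]; linear_combination hsq / 4
  have hle : 2 * lam ≤ s := by rw [hlam]; linarith [Real.sqrt_nonneg (s ^ 2 - 4)]
  have hprod : (s - β - lam) * (β - lam) = (1 + β ^ 2) ^ 2 := by
    linear_combination hroot + hsβ
  refine ⟨by nlinarith [sq_nonneg lam], ?_, by rw [hsa, hprod]⟩
  by_contra! hcon
  have : 0 < (1 + β ^ 2) ^ 2 := by positivity
  nlinarith

end StepFunction

lemma hasDerivAt_lyapunov {σ : Type*} [Fintype σ] (β : ℝ) {u w : ℝ → σ → ℝ} {u' w' : σ → ℝ}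
    {t : ℝ} (hu : HasDerivAt u u' t) (hw : HasDerivAt w w' t) :
    HasDerivAt (fun s => 1 / 2 * (u s ⬝ᵥ u s) + 1 / 2 * ((β • u s + w s) ⬝ᵥ (β • u s + w s)))
      (u t ⬝ᵥ u' + (β • u t + w t) ⬝ᵥ (β • u' + w')) t := by
  have hy : HasDerivAt (fun s => β • u s + w s) (β • u' + w') t := (hu.const_smul β).add hw
  refine (((hu.dotProduct hu).const_mul (1 / 2)).add
    ((hy.dotProduct hy).const_mul (1 / 2))).congr_deriv ?_
  rw [dotProduct_comm u', dotProduct_comm (β • u' + w')]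
  ring

/-- The Lie derivative of the Lyapunov function `½‖u‖² + ½‖βu + w‖²` along the error dynamics. -/
lemma lyapunov_derivative_le {σ : Type*} [Fintype σ] {B : Matrix σ σ ℝ}
    (hB : ∀ v, 0 ≤ v ⬝ᵥ (B *ᵥ v)) {α β lam Λ K : ℝ} (hβ : 0 < β) (hα : α = (β ^ 2 + 2) / β)
    (hlam : 0 < lam) (hlamβ : lam < β)
    (hdet : ((β ^ 4 + 2 * β ^ 2 + 2) / β - lam) * (β - lam) = (1 + β ^ 2) ^ 2)
    (hΛ : 0 < Λ) (hK : 0 < K) {u w g : σ → ℝ}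
    (hw : Λ / 2 * (w ⬝ᵥ w) ≤ w ⬝ᵥ (B *ᵥ w)) (hg : g ⬝ᵥ g ≤ 2 * K * (u ⬝ᵥ g)) :
    u ⬝ᵥ (-(α • (B *ᵥ u)) - B *ᵥ w - g) +
        (β • u + w) ⬝ᵥ (β • (-(α • (B *ᵥ u)) - B *ᵥ w - g) + B *ᵥ u) ≤
      -(lam * (u ⬝ᵥ (B *ᵥ u)) + (1 + β ^ 2 - K * β ^ 2 / (lam * Λ)) * (u ⬝ᵥ g)) := by
  have hform := hB ((1 + β ^ 2) • u + (β - lam) • w)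
  have hyoung := dotProduct_self_nonneg_real ((lam * Λ) • w + β • g)
  simp only [mulVec_add, mulVec_smul, dotProduct_add, add_dotProduct, dotProduct_sub,
    dotProduct_neg, dotProduct_smul, smul_dotProduct, smul_eq_mul, dotProduct_comm g w] at *
  set X := u ⬝ᵥ (B *ᵥ u)
  set Y₁ := u ⬝ᵥ (B *ᵥ w)
  set Y₂ := w ⬝ᵥ (B *ᵥ u)
  set Z := w ⬝ᵥ (B *ᵥ w)
  set P := u ⬝ᵥ g
  set Q := w ⬝ᵥ g
  set W := w ⬝ᵥ w
  set G := g ⬝ᵥ g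
  have hD : 0 < β - lam := by linarith
  have hm : 0 < lam * Λ := by positivity
  have h1 : 0 ≤ ((β ^ 4 + 2 * β ^ 2 + 2) / β - lam) * X + (1 + β ^ 2) * (Y₁ + Y₂)
      + (β - lam) * Z := by
    refine nonneg_of_mul_nonneg_right (a := β - lam) ?_ hD
    linear_combination hform - X * hdet
  have h2 : 0 ≤ K * β ^ 2 / (lam * Λ) * P + β * Q + lam * Z := by
    have e : K * β ^ 2 / (lam * Λ) * P = β ^ 2 * (2 * K * P) / (2 * (lam * Λ)) := by
      field_simp
    have e1 : β ^ 2 * G / (2 * (lam * Λ)) ≤ β ^ 2 * (2 * K * P) / (2 * (lam * Λ)) := by gcongr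
    have e2 : lam * (Λ / 2 * W) ≤ lam * Z := by gcongr
    have e3 : 0 ≤ β ^ 2 * G / (2 * (lam * Λ)) + β * Q + lam * (Λ / 2 * W) := by
      refine nonneg_of_mul_nonneg_right (a := 2 * (lam * Λ)) ?_ (by positivity)
      have : 2 * (lam * Λ) * (β ^ 2 * G / (2 * (lam * Λ)) + β * Q + lam * (Λ / 2 * W))
        = β ^ 2 * G + 2 * (lam * Λ) * β * Q + (lam * Λ) ^ 2 * W := by field_simp
      rw [this]
      linarith
    linarith
  have hαβ : α * β = β ^ 2 + 2 := by rw [hα]; field_simp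
  have ha : (β ^ 4 + 2 * β ^ 2 + 2) / β = α + β + β ^ 3 := by rw [hα]; field_simp; ring
  rw [ha] at h1
  linear_combination h1 + h2 - (β * X + Y₂) * hαβ

/-- Convergence of the error dynamics for a positive semidefinite coupling matrix `B` and a
cocoercive vector field `g`: trajectories approach every set containing the points where both
the coupling form and the monotonicity gap vanish. -/
lemma tendsto_infDist_of_cocoercive {σ : Type*} [Fintype σ] {B : Matrix σ σ ℝ}
    (hBnn : ∀ v, 0 ≤ v ⬝ᵥ (B *ᵥ v)) {α β lam Λ K : ℝ} (hβ : 0 < β) (hα : α = (β ^ 2 + 2) / β)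
    (hlam0 : 0 < lam) (hlamβ : lam < β)
    (hdet : ((β ^ 4 + 2 * β ^ 2 + 2) / β - lam) * (β - lam) = (1 + β ^ 2) ^ 2)
    (hΛ : 0 < Λ) (hK : 0 < K) (hε : 0 < 1 + β ^ 2 - K * β ^ 2 / (lam * Λ))
    {g : (σ → ℝ) → (σ → ℝ)} (hgcont : Continuous g) {X₀ Z₀ : σ → ℝ}
    (hBX₀ : B *ᵥ X₀ = 0) (hZ₀ : B *ᵥ Z₀ = -g X₀)
    (hcoc : ∀ X, (g X - g X₀) ⬝ᵥ (g X - g X₀) ≤ 2 * K * ((X - X₀) ⬝ᵥ (g X - g X₀)))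
    {x z : ℝ → σ → ℝ}
    (hx : ∀ t, HasDerivAt x (-(α • (B *ᵥ x t)) - B *ᵥ z t - g (x t)) t)
    (hz : ∀ t, HasDerivAt z (B *ᵥ x t) t)
    (hgap : ∀ t, Λ / 2 * ((z t - Z₀) ⬝ᵥ (z t - Z₀)) ≤ (z t - Z₀) ⬝ᵥ (B *ᵥ (z t - Z₀)))
    {S : Set (σ → ℝ)} (hS : ∀ X, (X - X₀) ⬝ᵥ (B *ᵥ (X - X₀)) = 0 →
      (X - X₀) ⬝ᵥ (g X - g X₀) = 0 → X ∈ S) :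
    Tendsto (fun t => Metric.infDist (x t) S) atTop (nhds 0) := by
  have hmono : ∀ X, 0 ≤ (X - X₀) ⬝ᵥ (g X - g X₀) := fun X =>
    nonneg_of_mul_nonneg_right ((dotProduct_self_nonneg_real _).trans (hcoc X))
      (by positivity : 0 < 2 * K)
  set R : (σ → ℝ) × (σ → ℝ) → ℝ := fun q =>
    lam * ((q.1 - X₀) ⬝ᵥ (B *ᵥ (q.1 - X₀))) + (1 + β ^ 2 - K * β ^ 2 / (lam * Λ)) *
      ((q.1 - X₀) ⬝ᵥ (g q.1 - g X₀))
  have hBcont : Continuous fun v => B *ᵥ v := continuous_const.matrix_mulVec continuous_id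
  have hRcont : Continuous R := by
    have h1 : Continuous fun q : (σ → ℝ) × (σ → ℝ) => q.1 - X₀ :=
      continuous_fst.sub continuous_const
    exact (continuous_const.mul (h1.dotProduct (hBcont.comp h1))).add
      (continuous_const.mul (h1.dotProduct ((hgcont.comp continuous_fst).sub continuous_const)))
  have hR0 : ∀ q, 0 ≤ R q := fun q =>
    add_nonneg (mul_nonneg hlam0.le (hBnn _)) (mul_nonneg hε.le (hmono _))
  have hRS : ∀ q, R q = 0 → Metric.infDist q.1 S = 0 := by
    intro q hq
    obtain ⟨h1, h2⟩ := (add_eq_zero_iff_of_nonneg (mul_nonneg hlam0.le (hBnn _))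
      (mul_nonneg hε.le (hmono _))).1 hq
    exact Metric.infDist_zero_of_mem (hS _ ((mul_eq_zero.1 h1).resolve_left hlam0.ne')
      ((mul_eq_zero.1 h2).resolve_left hε.ne'))
  set u : ℝ → (σ → ℝ) := fun t => x t - X₀ with hu
  set w : ℝ → (σ → ℝ) := fun t => z t - Z₀ with hw
  set V : ℝ → ℝ := fun t =>
    1 / 2 * (u t ⬝ᵥ u t) + 1 / 2 * ((β • u t + w t) ⬝ᵥ (β • u t + w t)) with hVdef
  set u' : ℝ → (σ → ℝ) := fun t =>
    -(α • (B *ᵥ u t)) - B *ᵥ w t - (g (x t) - g X₀) with hu'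
  have hBx : ∀ t, B *ᵥ x t = B *ᵥ u t := fun t => by rw [hu, mulVec_sub, hBX₀, sub_zero]
  have hdu : ∀ t, HasDerivAt u (u' t) t := fun t => by
    have e : u' t = -(α • (B *ᵥ x t)) - B *ᵥ z t - g (x t) := by
      have hBw : B *ᵥ w t = B *ᵥ z t + g X₀ := by
        simp only [hw, mulVec_sub, hZ₀, sub_neg_eq_add]
      simp only [hu']
      rw [hBx, hBw]
      abel
    rw [e]
    exact (hx t).sub_const X₀
  have hdw : ∀ t, HasDerivAt w (B *ᵥ u t) t := fun t => by
    rw [← hBx]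
    exact (hz t).sub_const Z₀
  have hdV : ∀ t, HasDerivAt V (u t ⬝ᵥ u' t + (β • u t + w t) ⬝ᵥ (β • u' t + B *ᵥ u t)) t :=
    fun t => hasDerivAt_lyapunov β (hdu t) (hdw t)
  have hdV' : ∀ t, u t ⬝ᵥ u' t + (β • u t + w t) ⬝ᵥ (β • u' t + B *ᵥ u t) ≤ -R (x t, z t) :=
    fun t => lyapunov_derivative_le hBnn hβ hα hlam0 hlamβ hdet hΛ hK (hgap t) (hcoc (x t))
  have hV0 : ∀ t, 0 ≤ V t := fun t => by
    have h1 := dotProduct_self_nonneg_real (u t)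
    have h2 := dotProduct_self_nonneg_real (β • u t + w t)
    simp only [hVdef]
    positivity
  have hVanti : Antitone V := antitone_of_deriv_nonpos (fun t => (hdV t).differentiableAt)
    fun t => by
      rw [(hdV t).deriv]
      exact (hdV' t).trans (neg_nonpos.2 (hR0 _))
  -- trajectories stay in a compact set
  obtain ⟨k, hk, hγk⟩ : ∃ k, IsCompact k ∧ ∀ t, 0 ≤ t → (x t, z t) ∈ k := by
    have hΦ : Continuous fun q : (σ → ℝ) × (σ → ℝ) => (X₀ + q.1, Z₀ + q.2 - β • q.1) :=
      (continuous_const.add continuous_fst).prodMk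
        ((continuous_const.add continuous_snd).sub (continuous_fst.const_smul β))
    refine ⟨_, (isCompact_closedBall 0 √(2 * V 0)).image hΦ, fun t ht =>
      ⟨(u t, β • u t + w t), ?_, ?_⟩⟩
    · have hVt : V t ≤ V 0 := hVanti ht
      have h1 := dotProduct_self_nonneg_real (u t)
      have h2 := dotProduct_self_nonneg_real (β • u t + w t)
      have e : V t = 1 / 2 * (u t ⬝ᵥ u t) + 1 / 2 * ((β • u t + w t) ⬝ᵥ (β • u t + w t)) := rfl
      rw [mem_closedBall_zero_iff, Prod.norm_mk]
      exact max_le ((norm_le_sqrt_dotProduct_self _).trans (Real.sqrt_le_sqrt (by linarith)))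
        ((norm_le_sqrt_dotProduct_self _).trans (Real.sqrt_le_sqrt (by linarith)))
    · simp only [hu, hw, Prod.mk.injEq]
      constructor <;> abel
  clear_value R V
  have hF : Continuous fun q : (σ → ℝ) × (σ → ℝ) =>
      (-(α • (B *ᵥ q.1)) - B *ᵥ q.2 - g q.1, B *ᵥ q.1) :=
    (((((hBcont.comp continuous_fst).const_smul α).neg).sub (hBcont.comp continuous_snd)).sub
      (hgcont.comp continuous_fst)).prodMk (hBcont.comp continuous_fst)
  have hRt := tendsto_dissipation_zero hk hF.continuousOn (γ := fun t => (x t, z t))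
    (fun t => (hx t).prodMk (hz t)) hγk hRcont.continuousOn hR0 hdV hdV' hV0
  exact tendsto_zero_of_compact_of_zeros_subset hk (R := R)
    (D := fun q => Metric.infDist q.1 S) (γ := fun t => (x t, z t))
    hRcont.continuousOn ((Metric.continuous_infDist_pt S).comp continuous_fst) hR0
    (fun _ => Metric.infDist_nonneg) (fun q _ => hRS q) hγk hRt

/-- Main convergence theorem. For a strongly connected, weight-balanced
digraph and convex differentiable `f^i` with globally `K`-Lipschitz gradients, there is
`β* > 0`, a root of the function `h` of the paper, such that for all `0 < β < β*` and
`α = (β² + 2)/β`, the first component of any trajectory of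
`ẋ = −α𝐋x − 𝐋z − ∇f̃(x), ż = 𝐋x` asymptotically converges to the set
`{1_n ⊗ x : x minimizes ∑ i, f^i}`. -/
theorem distributed_optimization_convergence_weight_balanced
    {n d : ℕ}
    (A : Matrix (Fin n) (Fin n) ℝ)
    (hA : ∀ i j, 0 ≤ A i j)
    (hconn : ∀ i j : Fin n, i ≠ j → Relation.TransGen (fun a b => 0 < A a b) i j)
    (hbal : ∀ i, ∑ j, A i j = ∑ j, A j i)
    (L : Matrix (Fin n) (Fin n) ℝ)
    (hL : L = Matrix.diagonal (fun i => ∑ j, A i j) - A)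
    (BL : Matrix (Fin n × Fin d) (Fin n × Fin d) ℝ)
    (hBL : BL = Matrix.kroneckerMap (· * ·) L (1 : Matrix (Fin d) (Fin d) ℝ))
    (f : Fin n → (Fin d → ℝ) → ℝ)
    (hconv : ∀ i, ConvexOn ℝ Set.univ (f i))
    (gf : Fin n → (Fin d → ℝ) → (Fin d → ℝ))
    (hgrad : ∀ (i : Fin n) (v w : Fin d → ℝ),
      HasDerivAt (fun s : ℝ => f i (v + s • w)) (gf i v ⬝ᵥ w) 0)
    (K : ℝ) (hK : 0 < K)
    (hlipgrad : ∀ (i : Fin n) (v w : Fin d → ℝ),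
      (gf i v - gf i w) ⬝ᵥ (gf i v - gf i w) ≤ K ^ 2 * ((v - w) ⬝ᵥ (v - w)))
    (Λ : ℝ) (hΛpos : 0 < Λ)
    (hΛeig : ∃ v : Fin n → ℝ, v ≠ 0 ∧ (L + Lᵀ) *ᵥ v = Λ • v)
    (hΛmin : ∀ (μ : ℝ) (v : Fin n → ℝ), v ≠ 0 → (L + Lᵀ) *ᵥ v = μ • v → μ ≠ 0 → Λ ≤ |μ|)
    (h : ℝ → ℝ)
    (hh : h = fun r => (1 / 2) * Λ *
        (-((r ^ 4 + 3 * r ^ 2 + 2) / r) +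
          Real.sqrt (((r ^ 4 + 3 * r ^ 2 + 2) / r) ^ 2 - 4)) +
        K * r ^ 2 / (1 + r ^ 2)) :
    ∃ βs : ℝ, 0 < βs ∧ h βs = 0 ∧
      ∀ β : ℝ, 0 < β → β < βs →
        ∀ α : ℝ, α = (β ^ 2 + 2) / β →
          ∀ x z : ℝ → (Fin n × Fin d → ℝ),
            (∀ t, HasDerivAt x
              (-(α • (BL *ᵥ x t)) - BL *ᵥ z t -
                (fun p => gf p.1 (fun j => x t (p.1, j)) p.2)) t) →
            (∀ t, HasDerivAt z (BL *ᵥ x t) t) →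
            Tendsto (fun t => Metric.infDist (x t)
                {X : Fin n × Fin d → ℝ | ∃ xm : Fin d → ℝ,
                  X = (fun p => xm p.2) ∧ ∀ y : Fin d → ℝ, ∑ i, f i xm ≤ ∑ i, f i y})
              atTop (nhds 0) := by
  subst hBL
  set BL := Matrix.kroneckerMap (· * ·) L (1 : Matrix (Fin d) (Fin d) ℝ) with hBL
  obtain ⟨βs, hβs, hroot, hneg⟩ := exists_first_zero_step_function hΛpos hK hh
  refine ⟨βs, hβs, hroot, fun β hβ hββs α hα x z hx hz => ?_⟩
  set S : Set (Fin n × Fin d → ℝ) := {X | ∃ xm : Fin d → ℝ,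
    X = (fun p => xm p.2) ∧ ∀ y : Fin d → ℝ, ∑ i, f i xm ≤ ∑ i, f i y}
  rcases S.eq_empty_or_nonempty with hSe | ⟨X₀, xm, hX₀, hxm⟩
  · simp [hSe]
  have : Nonempty (Fin n) := by
    obtain ⟨v, hv, -⟩ := hΛeig
    by_contra hne
    rw [not_nonempty_iff] at hne
    exact hv (Subsingleton.elim _ _)
  have hβneg := hneg β hβ hββs
  -- the stacked gradient and its properties
  set g : (Fin n × Fin d → ℝ) → (Fin n × Fin d → ℝ) :=
    fun X p => gf p.1 (fun j => X (p.1, j)) p.2 with hg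
  have hgcont : Continuous g := by
    refine continuous_pi fun p => (continuous_apply p.2).comp
      ((continuous_of_dotProduct_lipschitz (hlipgrad p.1)).comp ?_)
    exact continuous_pi fun j => continuous_apply (p.1, j)
  have hcoc : ∀ X, (g X - g X₀) ⬝ᵥ (g X - g X₀) ≤ 2 * K * ((X - X₀) ⬝ᵥ (g X - g X₀)) := by
    intro X
    simp only [dotProduct, Fintype.sum_prod_type, Finset.mul_sum (a := 2 * K)]
    refine Finset.sum_le_sum fun i _ => ?_
    rw [← Finset.mul_sum]
    exact (hconv i).gradient_cocoercive (hgrad i) hK (hlipgrad i)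
      (fun j => X₀ (i, j)) (fun j => X (i, j))
  have hgrad0 : ∀ j, ∑ i, gf i xm j = 0 := sum_gradient_eq_zero_of_minimizer hgrad hxm
  -- the block Laplacian
  have hBnn : ∀ v, 0 ≤ v ⬝ᵥ (BL *ᵥ v) := fun v => by
    rw [hBL, dotProduct_kronecker_one_mulVec]
    exact Finset.sum_nonneg fun j _ => dotProduct_laplacian_mulVec_nonneg hA hbal hL _
  have hBX₀ : BL *ᵥ X₀ = 0 := by
    ext p
    rw [hBL, kronecker_one_mulVec, hX₀]
    exact congrFun (laplacian_mulVec_const hL (xm p.2)) p.1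
  have hzsum : ∀ t j, ∑ i, z t (i, j) = ∑ i, z 0 (i, j) := fun t j => by
    have hd : ∀ s, HasDerivAt (fun s => ∑ i, z s (i, j)) 0 s := fun s => by
      have h0 : ∑ i, (BL *ᵥ x s) (i, j) = 0 := by
        simp only [hBL, kronecker_one_mulVec]
        exact sum_laplacian_mulVec hbal hL _
      rw [← h0]
      exact HasDerivAt.fun_sum fun i _ => hasDerivAt_pi.1 (hz s) (i, j)
    exact is_const_of_deriv_eq_zero (fun s => (hd s).differentiableAt) (fun s => (hd s).deriv) t 0
  obtain ⟨Z₀, hZ₀, hZ₀sum⟩ : ∃ Z₀ : Fin n × Fin d → ℝ,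
      BL *ᵥ Z₀ = -g X₀ ∧ ∀ j, ∑ i, Z₀ (i, j) = ∑ i, z 0 (i, j) := by
    choose ζ hζ hζsum using fun j : Fin d =>
      exists_laplacian_mulVec_eq hA hconn hbal hL (c := fun i => -gf i xm j)
        (by rw [Finset.sum_neg_distrib, hgrad0, neg_zero]) (∑ i, z 0 (i, j))
    refine ⟨fun p => ζ p.2 p.1, ?_, hζsum⟩
    ext p
    rw [hBL, kronecker_one_mulVec, hζ, Pi.neg_apply, hg, hX₀]
  have hgap : ∀ t, Λ / 2 * ((z t - Z₀) ⬝ᵥ (z t - Z₀)) ≤ (z t - Z₀) ⬝ᵥ (BL *ᵥ (z t - Z₀)) := by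
    intro t
    have e : (z t - Z₀) ⬝ᵥ (z t - Z₀) =
        ∑ j, (fun i => (z t - Z₀) (i, j)) ⬝ᵥ fun i => (z t - Z₀) (i, j) := by
      simp only [dotProduct]
      rw [Fintype.sum_prod_type, Finset.sum_comm]
    rw [hBL, dotProduct_kronecker_one_mulVec, e, Finset.mul_sum]
    refine Finset.sum_le_sum fun j _ =>
      spectral_gap_laplacian hA hconn hbal hL hΛmin ?_
    simp [Finset.sum_sub_distrib, hzsum, hZ₀sum]
  set lam := ((β ^ 4 + 3 * β ^ 2 + 2) / β - √(((β ^ 4 + 3 * β ^ 2 + 2) / β) ^ 2 - 4)) / 2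
    with hlam
  obtain ⟨hlam0, hlamβ, hdet⟩ := step_eigenvalue hβ hlam
  have hε : 0 < 1 + β ^ 2 - K * β ^ 2 / (lam * Λ) := by
    have h1 : K * β ^ 2 / (1 + β ^ 2) < lam * Λ := by
      rw [hh] at hβneg
      dsimp only at hβneg
      rw [hlam]
      linarith
    rw [sub_pos]
    rwa [div_lt_comm₀ (by positivity) (by positivity)] at h1
  refine tendsto_infDist_of_cocoercive hBnn hβ hα hlam0 hlamβ hdet hΛpos hK hε hgcont hBX₀ hZ₀
    hcoc hx hz hgap fun X h1 h2 => ?_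
  let i₀ : Fin n := Classical.arbitrary _
  rw [hBL, dotProduct_kronecker_one_mulVec] at h1
  have hXy : X = fun p => X (i₀, p.2) := by
    ext ⟨i, j⟩
    have := (Finset.sum_eq_zero_iff_of_nonneg fun j _ =>
      dotProduct_laplacian_mulVec_nonneg hA hbal hL _).1 h1 j (Finset.mem_univ j)
    have := eq_of_dotProduct_laplacian_mulVec_eq_zero hA hconn hbal hL this i i₀
    simpa [hX₀] using this
  set y : Fin d → ℝ := fun j => X (i₀, j) with hy
  refine ⟨y, hXy, fun y' => le_trans ?_ (hxm y')⟩
  have hgX : (X - X₀) ⬝ᵥ (g X - g X₀) = ∑ i, gf i y ⬝ᵥ (y - xm) := by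
    have e : ∑ i, gf i xm ⬝ᵥ (y - xm) = 0 := by
      rw [← sum_dotProduct, show ∑ i, gf i xm = 0 from funext fun j => by simp [hgrad0],
        zero_dotProduct]
    rw [← sub_zero (∑ i, gf i y ⬝ᵥ (y - xm)), ← e, ← Finset.sum_sub_distrib, hXy, hX₀, hg]
    simp only [dotProduct, Fintype.sum_prod_type, ← Finset.sum_sub_distrib, Pi.sub_apply]
    exact Finset.sum_congr rfl fun i _ => Finset.sum_congr rfl fun j _ => by ring
  have hfirst := Finset.sum_le_sum fun i (_ : i ∈ Finset.univ) =>
    (hconv i).add_dotProduct_le (hgrad i y) xm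
  rw [Finset.sum_add_distrib] at hfirst
  have e : ∑ i, gf i y ⬝ᵥ (xm - y) = 0 := by
    rw [← neg_sub y xm]
    simp only [dotProduct_neg, Finset.sum_neg_distrib]
    rw [← hgX, h2, neg_zero]
  linarith
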